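/- For every ε > 0 there exists a constant C = C(ε) > 0 such that for every prime p, all intervals I_1, I_2 ⊂ F_p not containing 0, of cardinalities N_1 and N_2 respectively (in arbitrary position), all complex coefficients α_1(x_1), α_2(x_2) with |α_1(x_1)| ≤ 1 and |α_2(x_2)| ≤ 1, and every a ∈ F_p with a ≠ 0, one has |∑_{x_1∈I_1} ∑_{x_2∈I_2} α_1(x_1) α_2(x_2) e_p(a x_1^{-1} x_2^{-1})| ≤ C·(N_1 N_2)^{ε}·p^{1/8}·N_1^{3/4}·N_2^{3/4}·(N_1³/p + 1)^{1/16}·(N_2³/p + 1)^{1/16}. -/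

import Mathlib

open Finset

/-- The interval `{a+1, a+2, …, a+N}` in `ZMod p`. -/
def interval (p : ℕ) (a : ZMod p) (N : ℕ) : Finset (ZMod p) :=
  (Finset.Icc 1 N).image (fun i : ℕ => a + (i : ZMod p))

/-- `e_p(z) = exp(2πi z/p)` for `z ∈ ZMod p`. -/
noncomputable def ep (p : ℕ) (z : ZMod p) : ℂ :=
  Complex.exp (2 * (Real.pi : ℂ) * Complex.I * (z.val : ℂ) / (p : ℂ))

theorem exists_card_divisors_le_mul_rpow {ε : ℝ} (hε : 0 < ε) :
    ∃ C : ℝ, 0 < C ∧ ∀ n : ℕ, n ≠ 0 → (#n.divisors : ℝ) ≤ C * (n : ℝ) ^ ε := by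
  obtain ⟨B, hB⟩ := exists_nat_ge ((2 : ℝ) ^ ε⁻¹)
  set K : ℝ := 1 + (ε * Real.log 2)⁻¹ with hK
  have hl : 0 < ε * Real.log 2 := by positivity
  have hK1 : 1 ≤ K := by rw [hK]; have := inv_pos.2 hl; linarith
  have hsmall : ∀ q v : ℕ, 2 ≤ q → (v + 1 : ℝ) ≤ K * ((q : ℝ) ^ v) ^ ε := by
    intro q v hq
    have h1 : ((2 : ℝ) ^ v) ^ ε ≤ ((q : ℝ) ^ v) ^ ε := by
      have : (2 : ℝ) ≤ q := by exact_mod_cast hq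
      gcongr
    have h2 : 1 + v * (ε * Real.log 2) ≤ ((2 : ℝ) ^ v) ^ ε := by
      rw [Real.rpow_def_of_pos (by positivity), Real.log_pow]
      have := Real.add_one_le_exp ((v : ℝ) * Real.log 2 * ε)
      linarith
    calc (v + 1 : ℝ) ≤ K * (1 + v * (ε * Real.log 2)) := by
          have : K * (1 + v * (ε * Real.log 2)) = 1 + v + (ε * Real.log 2)⁻¹ +
            v * (ε * Real.log 2) := by rw [hK]; field_simp; ring
          rw [this]
          have : 0 ≤ (ε * Real.log 2)⁻¹ + v * (ε * Real.log 2) := by positivity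
          linarith
      _ ≤ _ := by gcongr; exact h2.trans h1
  have hlarge : ∀ q v : ℕ, B ≤ q → (v + 1 : ℝ) ≤ ((q : ℝ) ^ v) ^ ε := by
    intro q v hq
    have h1 : (2 : ℝ) ^ ε⁻¹ ≤ q := hB.trans (by exact_mod_cast hq)
    have h2 : (2 : ℝ) ≤ (q : ℝ) ^ ε := by
      have := Real.rpow_le_rpow (by positivity) h1 hε.le
      rwa [← Real.rpow_mul (by norm_num), inv_mul_cancel₀ hε.ne', Real.rpow_one] at this
    calc (v + 1 : ℝ) ≤ 2 ^ v := by exact_mod_cast Nat.lt_two_pow_self (n := v)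
      _ ≤ ((q : ℝ) ^ ε) ^ v := by gcongr
      _ = _ := by rw [← Real.rpow_mul_natCast (by positivity), mul_comm,
                    Real.rpow_natCast_mul (by positivity)]
  refine ⟨K ^ B, by positivity, fun n hn => ?_⟩
  have hprod : (n : ℝ) ^ ε = ∏ q ∈ n.primeFactors, ((q : ℝ) ^ n.factorization q) ^ ε := by
    conv_lhs => rw [← Nat.prod_factorization_pow_eq_self hn]
    rw [Finsupp.prod, Nat.support_factorization]
    push_cast
    rw [Real.finsetProd_rpow _ _ (fun i _ => by positivity)]
  rw [Nat.card_divisors hn, hprod]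
  push_cast
  calc ∏ q ∈ n.primeFactors, ((n.factorization q : ℝ) + 1)
      ≤ ∏ q ∈ n.primeFactors, (if q < B then K else 1) * ((q : ℝ) ^ n.factorization q) ^ ε := by
        refine prod_le_prod (fun i _ => by positivity) fun q hq => ?_
        split_ifs with h
        · exact hsmall q _ (Nat.prime_of_mem_primeFactors hq).two_le
        · rw [one_mul]; exact hlarge q _ (not_lt.1 h)
    _ = (∏ q ∈ n.primeFactors, (if q < B then K else 1)) *
          ∏ q ∈ n.primeFactors, ((q : ℝ) ^ n.factorization q) ^ ε := prod_mul_distrib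
    _ ≤ _ := by
        gcongr
        rw [prod_ite, prod_const, prod_const_one, mul_one]
        refine pow_le_pow_right₀ hK1 ?_
        calc _ ≤ #(range B) := card_le_card fun q hq => by simpa using (mem_filter.1 hq).2
          _ = B := card_range B

theorem card_le_of_mul_eq {n : ℤ} (hn : n ≠ 0) (S : Finset (ℤ × ℤ))
    (hS : ∀ q ∈ S, q.1 * q.2 = n) : #S ≤ 2 * #n.natAbs.divisors := by
  have hinj : Set.InjOn (fun q : ℤ × ℤ => (decide (0 ≤ q.1), q.1.natAbs)) S := by
    rintro ⟨a, b⟩ h1 ⟨c, d⟩ h2 h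
    have e1 := hS _ h1
    have e2 := hS _ h2
    simp only [Prod.mk.injEq, decide_eq_decide] at h e1 e2
    have hac : a = c := by omega
    subst hac
    have ha : a ≠ 0 := by rintro rfl; simp at e1; exact hn e1.symm
    simpa using mul_left_cancel₀ ha (e1.trans e2.symm)
  have hmaps : ∀ q ∈ S, (fun q : ℤ × ℤ => (decide (0 ≤ q.1), q.1.natAbs)) q ∈
      (univ : Finset Bool) ×ˢ n.natAbs.divisors := by
    intro q hq
    simp only [mem_product, mem_univ, true_and, Nat.mem_divisors]
    exact ⟨Int.natAbs_dvd_natAbs.2 ⟨q.2, (hS q hq).symm⟩, by simpa using hn⟩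
  simpa using card_le_card_of_injOn _ hmaps hinj

/-- Integer points on `(A x + B) (A y + B) = n`, no two of them on a common horizontal or vertical
line. -/
theorem card_le_of_hyperbola {A B n : ℤ} (hA : A ≠ 0) (S : Finset (ℤ × ℤ))
    (h1 : Set.InjOn Prod.fst (S : Set (ℤ × ℤ))) (h2 : Set.InjOn Prod.snd (S : Set (ℤ × ℤ)))
    (hS : ∀ q ∈ S, (A * q.1 + B) * (A * q.2 + B) = n) : #S ≤ 2 * #n.natAbs.divisors + 2 := by
  rcases eq_or_ne n 0 with rfl | hn
  · have hsub : S ⊆ {q ∈ S | A * q.1 + B = 0} ∪ {q ∈ S | A * q.2 + B = 0} := by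
      intro q hq
      have := mul_eq_zero.1 (hS q hq)
      simp only [mem_union, mem_filter]
      tauto
    have c1 : #{q ∈ S | A * q.1 + B = 0} ≤ 1 := by
      refine card_le_one.2 fun x hx y hy => ?_
      rw [mem_filter] at hx hy
      exact h1 hx.1 hy.1 (mul_left_cancel₀ hA (add_right_cancel (hx.2.trans hy.2.symm)))
    have c2 : #{q ∈ S | A * q.2 + B = 0} ≤ 1 := by
      refine card_le_one.2 fun x hx y hy => ?_
      rw [mem_filter] at hx hy
      exact h2 hx.1 hy.1 (mul_left_cancel₀ hA (add_right_cancel (hx.2.trans hy.2.symm)))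
    have := card_le_card hsub
    have := card_union_le {q ∈ S | A * q.1 + B = 0} {q ∈ S | A * q.2 + B = 0}
    omega
  · have hinj : Set.InjOn (fun q : ℤ × ℤ => (A * q.1 + B, A * q.2 + B)) S := by
      rintro ⟨a, b⟩ - ⟨c, d⟩ - h
      simp only [Prod.mk.injEq, add_left_inj, mul_eq_mul_left_iff, hA, or_false] at h
      simp [h]
    rw [← card_image_of_injOn hinj]
    have := card_le_of_mul_eq hn (S.image fun q : ℤ × ℤ => (A * q.1 + B, A * q.2 + B)) (by
      simp only [mem_image]
      rintro _ ⟨q, hq, rfl⟩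
      exact hS q hq)
    omega

section Hyperbola

variable {p : ℕ} [Fact p.Prime] {N : ℕ} {s c : ZMod p} {S : Finset (ℤ × ℤ)}

theorem eq_of_intCast_eq_of_mem_Icc (hN : N < p) {x y : ℤ} (hx : x ∈ Set.Icc 1 (N : ℤ))
    (hy : y ∈ Set.Icc 1 (N : ℤ)) (h : (x : ZMod p) = y) : x = y := by
  rw [ZMod.intCast_eq_intCast_iff_dvd_sub] at h
  obtain ⟨hx1, hx2⟩ := hx
  obtain ⟨hy1, hy2⟩ := hy
  have := Int.eq_zero_of_abs_lt_dvd h (by rw [abs_lt]; constructor <;> omega)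
  omega

theorem injOn_fst_of_hyperbola (hN : N < p) (hc : c ≠ 0)
    (hS2 : ∀ q ∈ S, q.2 ∈ Set.Icc 1 (N : ℤ))
    (hS : ∀ q ∈ S, ((q.1 : ZMod p) + s) * ((q.2 : ZMod p) + s) = c) :
    Set.InjOn Prod.fst (S : Set (ℤ × ℤ)) := by
  rintro ⟨x, y⟩ h1 ⟨x', y'⟩ h2 (rfl : x = x')
  have e1 := hS _ h1
  have e2 := hS _ h2
  have hx : (x : ZMod p) + s ≠ 0 := by
    intro h
    simp only [h, zero_mul] at e1
    exact hc e1.symm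
  have := eq_of_intCast_eq_of_mem_Icc hN (hS2 _ h1) (hS2 _ h2)
    (add_right_cancel (mul_left_cancel₀ hx (e1.trans e2.symm)))
  exact Prod.ext rfl this

theorem injOn_snd_of_hyperbola (hN : N < p) (hc : c ≠ 0)
    (hS1 : ∀ q ∈ S, q.1 ∈ Set.Icc 1 (N : ℤ))
    (hS : ∀ q ∈ S, ((q.1 : ZMod p) + s) * ((q.2 : ZMod p) + s) = c) :
    Set.InjOn Prod.snd (S : Set (ℤ × ℤ)) := by
  rintro ⟨x, y⟩ h1 ⟨x', y'⟩ h2 (rfl : y = y')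
  have e1 := hS _ h1
  have e2 := hS _ h2
  have hx : (y : ZMod p) + s ≠ 0 := by
    intro h
    simp only [h, mul_zero] at e1
    exact hc e1.symm
  have := eq_of_intCast_eq_of_mem_Icc hN (hS1 _ h1) (hS1 _ h2)
    (add_right_cancel (mul_right_cancel₀ hx (e1.trans e2.symm)))
  exact Prod.ext this rfl

theorem abs_mul_sub_mul_le {x y x₀ y₀ : ℤ} (hx : x ∈ Set.Icc 1 (N : ℤ))
    (hy : y ∈ Set.Icc 1 (N : ℤ)) (hx₀ : x₀ ∈ Set.Icc 1 (N : ℤ)) (hy₀ : y₀ ∈ Set.Icc 1 (N : ℤ)) :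
    |x * y - x₀ * y₀| ≤ (N : ℤ) ^ 2 := by
  obtain ⟨hx1, hx2⟩ := hx
  obtain ⟨hy1, hy2⟩ := hy
  obtain ⟨hx3, hx4⟩ := hx₀
  obtain ⟨hy3, hy4⟩ := hy₀
  have h1 : x * y ≤ (N : ℤ) * N := by gcongr
  have h2 : x₀ * y₀ ≤ (N : ℤ) * N := by gcongr
  have h3 : 0 ≤ x * y := by positivity
  have h4 : 0 ≤ x₀ * y₀ := by positivity
  rw [abs_le]
  constructor <;> nlinarith

theorem abs_add_sub_add_le {x y x₀ y₀ : ℤ} (hx : x ∈ Set.Icc 1 (N : ℤ))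
    (hy : y ∈ Set.Icc 1 (N : ℤ)) (hx₀ : x₀ ∈ Set.Icc 1 (N : ℤ)) (hy₀ : y₀ ∈ Set.Icc 1 (N : ℤ)) :
    |x + y - (x₀ + y₀)| ≤ 2 * (N : ℤ) := by
  obtain ⟨hx1, hx2⟩ := hx
  obtain ⟨hy1, hy2⟩ := hy
  obtain ⟨hx3, hx4⟩ := hx₀
  obtain ⟨hy3, hy4⟩ := hy₀
  rw [abs_le]
  constructor <;> linarith

/-- For short intervals all solutions lie on one rational hyperbola, since the determinants formed
from the vectors `(x y, x + y, 1)` are divisible by `p` and smaller than `p`. -/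
theorem card_hyperbola_le_of_short {D : ℕ} (hN : N < p) (hc : c ≠ 0) (hNp : 4 * N ^ 3 < p)
    (hD : ∀ m ≤ 9 * N ^ 4, #m.divisors ≤ D)
    (hS1 : ∀ q ∈ S, q.1 ∈ Set.Icc 1 (N : ℤ)) (hS2 : ∀ q ∈ S, q.2 ∈ Set.Icc 1 (N : ℤ))
    (hS : ∀ q ∈ S, ((q.1 : ZMod p) + s) * ((q.2 : ZMod p) + s) = c) :
    #S ≤ 2 * D + 2 := by
  have i1 := injOn_fst_of_hyperbola hN hc hS2 hS
  have i2 := injOn_snd_of_hyperbola hN hc hS1 hS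
  rcases S.eq_empty_or_nonempty with rfl | ⟨⟨x₀, y₀⟩, h0⟩
  · simp
  have hcong : ∀ q ∈ S, ((q.1 * q.2 - x₀ * y₀ : ℤ) : ZMod p) =
      - s * ((q.1 + q.2 - (x₀ + y₀) : ℤ) : ZMod p) := by
    intro q hq
    have e1 := hS _ hq
    have e2 := hS _ h0
    push_cast
    linear_combination e1 - e2
  have hNp' : 4 * (N : ℤ) ^ 3 < p := by exact_mod_cast hNp
  by_cases hQ : ∀ q ∈ S, q.1 + q.2 = x₀ + y₀
  · have := card_le_of_hyperbola (A := 1) (B := -x₀) (n := 0) one_ne_zero S i1 i2 (by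
      intro q hq
      have e := hcong q hq
      rw [hQ q hq, sub_self, Int.cast_zero, mul_zero, ZMod.intCast_zmod_eq_zero_iff_dvd] at e
      have hN2 : (N : ℤ) ^ 2 < p := by
        have : (N : ℤ) ^ 2 ≤ (N : ℤ) ^ 3 := by
          rcases Nat.eq_zero_or_pos N with rfl | h
          · simp
          · exact pow_le_pow_right₀ (by exact_mod_cast h) (by norm_num)
        nlinarith [pow_nonneg (Int.natCast_nonneg N) 3]
      have := Int.eq_zero_of_abs_lt_dvd e
        ((abs_mul_sub_mul_le (hS1 q hq) (hS2 q hq) (hS1 _ h0) (hS2 _ h0)).trans_lt hN2)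
      linear_combination this - x₀ * hQ q hq)
    simp at this
    omega
  · push Not at hQ
    obtain ⟨q₁, hq₁, hne⟩ := hQ
    set A := q₁.1 + q₁.2 - (x₀ + y₀) with hA
    set P := q₁.1 * q₁.2 - x₀ * y₀ with hP
    have hA0 : A ≠ 0 := sub_ne_zero.2 hne
    have bA : |A| ≤ 2 * (N : ℤ) := abs_add_sub_add_le (hS1 _ hq₁) (hS2 _ hq₁) (hS1 _ h0) (hS2 _ h0)
    have bP : |P| ≤ (N : ℤ) ^ 2 := abs_mul_sub_mul_le (hS1 _ hq₁) (hS2 _ hq₁) (hS1 _ h0) (hS2 _ h0)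
    have hlin : ∀ x ∈ Set.Icc 1 (N : ℤ), |A * x + -P| ≤ 3 * (N : ℤ) ^ 2 := by
      rintro x ⟨hx1, hx2⟩
      calc |A * x + -P| ≤ |A * x| + |-P| := abs_add_le _ _
        _ = |A| * x + |P| := by rw [abs_mul, abs_neg, abs_of_pos (by omega : 0 < x)]
        _ ≤ 2 * N * N + (N : ℤ) ^ 2 := by gcongr
        _ = _ := by ring
    refine (card_le_of_hyperbola (B := -P) (n := (A * x₀ + -P) * (A * y₀ + -P)) hA0 S
      i1 i2 ?_).trans ?_
    · intro q hq
      have e : (((q.1 * q.2 - x₀ * y₀) * A - P * (q.1 + q.2 - (x₀ + y₀)) : ℤ) : ZMod p) = 0 := by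
        rw [Int.cast_sub, Int.cast_mul, Int.cast_mul, hcong q hq, hP, hcong q₁ hq₁, hA]
        ring
      rw [ZMod.intCast_zmod_eq_zero_iff_dvd] at e
      have := Int.eq_zero_of_abs_lt_dvd e (by
        calc _ ≤ |(q.1 * q.2 - x₀ * y₀) * A| + |P * (q.1 + q.2 - (x₀ + y₀))| := abs_sub _ _
          _ = |q.1 * q.2 - x₀ * y₀| * |A| + |P| * |q.1 + q.2 - (x₀ + y₀)| := by
            rw [abs_mul, abs_mul]
          _ ≤ (N : ℤ) ^ 2 * (2 * N) + (N : ℤ) ^ 2 * (2 * N) := by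
            gcongr
            · exact abs_mul_sub_mul_le (hS1 q hq) (hS2 q hq) (hS1 _ h0) (hS2 _ h0)
            · exact abs_add_sub_add_le (hS1 q hq) (hS2 q hq) (hS1 _ h0) (hS2 _ h0)
          _ = 4 * (N : ℤ) ^ 3 := by ring
          _ < p := hNp')
      linear_combination A * this
    · gcongr
      apply hD
      zify
      rw [abs_mul]
      calc _ ≤ (3 * (N : ℤ) ^ 2) * (3 * (N : ℤ) ^ 2) := by
            gcongr
            · exact hlin _ (hS1 _ h0)
            · exact hlin _ (hS2 _ h0)
        _ = _ := by ring

/-- Dirichlet approximation of `s / p` turns the congruence into few equations over the integers. -/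
theorem card_hyperbola_le {D : ℕ} (hN : N < p) (hc : c ≠ 0)
    (hD : ∀ m ≤ 9 * p ^ 2, #m.divisors ≤ D)
    (hS1 : ∀ q ∈ S, q.1 ∈ Set.Icc 1 (N : ℤ)) (hS2 : ∀ q ∈ S, q.2 ∈ Set.Icc 1 (N : ℤ))
    (hS : ∀ q ∈ S, ((q.1 : ZMod p) + s) * ((q.2 : ZMod p) + s) = c) :
    (#S : ℝ) ≤ 9 * √((N : ℝ) ^ 3 / p + 1) * (2 * D + 2) := by
  have i1 := injOn_fst_of_hyperbola hN hc hS2 hS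
  have i2 := injOn_snd_of_hyperbola hN hc hS1 hS
  rcases S.eq_empty_or_nonempty with rfl | ⟨⟨x₀, y₀⟩, h0⟩
  · simp; positivity
  have hN1 : 1 ≤ N := by have := hS1 _ h0; have := this.1.trans this.2; exact_mod_cast this
  have hp0 : (0 : ℝ) < p := by exact_mod_cast (Fact.out : p.Prime).pos
  have hN0 : (0 : ℝ) < N := by exact_mod_cast hN1
  have hNp : (N : ℝ) < p := by exact_mod_cast hN
  set r := √((p : ℝ) / N) with hr
  have hr2 : r ^ 2 = p / N := Real.sq_sqrt (by positivity)
  have hr1 : 1 ≤ r := by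
    rw [hr, Real.one_le_sqrt, one_le_div hN0]; exact hNp.le
  set W := (N : ℝ) / r with hW
  have hpr : (p : ℝ) = r ^ 2 * N := by rw [hr2]; field_simp
  have hW2 : W ^ 2 = (N : ℝ) ^ 3 / p := by rw [hW, hpr]; field_simp
  set T := ⌈r⌉₊
  have hrT : r ≤ T := Nat.le_ceil r
  have hTr : (T : ℝ) ≤ 2 * r := by
    have := Nat.ceil_lt_add_one (by linarith : 0 ≤ r)
    linarith
  have hT0 : 0 < T := Nat.ceil_pos.2 (by linarith)
  obtain ⟨j, t, ht0, htT, hjt⟩ := Real.exists_int_int_abs_mul_sub_le ((s.val : ℝ) / p) hT0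
  set b : ℤ := t * s.val - p * j with hb
  have hbs : (b : ZMod p) = t * s := by simp [hb]
  have htT' : (t : ℝ) ≤ T := by exact_mod_cast htT
  have ht0' : (0 : ℝ) < t := by exact_mod_cast ht0
  have hbr : |(b : ℝ)| ≤ p / r := by
    have e : (b : ℝ) = p * (t * (s.val / p) - j) := by rw [hb]; push_cast; field_simp
    rw [e, abs_mul, abs_of_pos hp0, div_eq_mul_one_div (p : ℝ) r]
    gcongr
    refine hjt.trans ?_
    gcongr
    linarith
  have hcong : ∀ q ∈ S, (p : ℤ) ∣ t * (q.1 * q.2 - x₀ * y₀) + b * (q.1 + q.2 - (x₀ + y₀)) := by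
    intro q hq
    rw [← ZMod.intCast_zmod_eq_zero_iff_dvd]
    have e1 := hS _ hq
    have e2 := hS _ h0
    push_cast
    rw [hbs]
    linear_combination t * (e1 - e2)
  set Z := ⌊4 * W⌋₊
  have hW0 : 0 ≤ W := by positivity
  set g : ℤ × ℤ → ℤ := fun q => (t * (q.1 * q.2 - x₀ * y₀) + b * (q.1 + q.2 - (x₀ + y₀))) / p
  have hg : ∀ q ∈ S, t * (q.1 * q.2 - x₀ * y₀) + b * (q.1 + q.2 - (x₀ + y₀)) = p * g q :=
    fun q hq => (Int.mul_ediv_cancel' (hcong q hq)).symm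
  have hgZ : ∀ q ∈ S, g q ∈ Icc (-(Z : ℤ)) Z := by
    intro q hq
    rw [mem_Icc, ← abs_le]
    have b1 : |((q.1 * q.2 - x₀ * y₀ : ℤ) : ℝ)| ≤ N ^ 2 := by
      exact_mod_cast abs_mul_sub_mul_le (hS1 q hq) (hS2 q hq) (hS1 _ h0) (hS2 _ h0)
    have b2 : |((q.1 + q.2 - (x₀ + y₀) : ℤ) : ℝ)| ≤ 2 * N := by
      exact_mod_cast abs_add_sub_add_le (hS1 q hq) (hS2 q hq) (hS1 _ h0) (hS2 _ h0)
    have h1 : (p : ℝ) * |(g q : ℝ)| ≤ p * (4 * W) := by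
      calc (p : ℝ) * |(g q : ℝ)| = |((p * g q : ℤ) : ℝ)| := by
            push_cast; rw [abs_mul, abs_of_pos hp0]
        _ = |(t : ℝ) * ((q.1 * q.2 - x₀ * y₀ : ℤ) : ℝ) +
              b * ((q.1 + q.2 - (x₀ + y₀) : ℤ) : ℝ)| := by
            rw [← hg q hq]; push_cast; rfl
        _ ≤ t * |((q.1 * q.2 - x₀ * y₀ : ℤ) : ℝ)| +
              |(b : ℝ)| * |((q.1 + q.2 - (x₀ + y₀) : ℤ) : ℝ)| := by
            refine (abs_add_le _ _).trans_eq ?_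
            rw [abs_mul, abs_mul, abs_of_pos ht0']
        _ ≤ (2 * r) * N ^ 2 + p / r * (2 * N) := by
            gcongr
            exact htT'.trans hTr
        _ = p * (4 * W) := by rw [hW, hpr]; field_simp; ring
    have h2 : |(g q : ℝ)| ≤ 4 * W := le_of_mul_le_mul_left h1 hp0
    have h3 : |g q|.toNat ≤ Z := by
      refine Nat.le_floor ?_
      have : ((|g q|.toNat : ℤ) : ℝ) = |(g q : ℝ)| := by
        rw [Int.toNat_of_nonneg (abs_nonneg _)]; push_cast; rfl
      rw [← this] at h2
      exact_mod_cast h2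
    omega
  have hlin : ∀ x ∈ Set.Icc 1 (N : ℤ), |t * x + b| ≤ 3 * (p : ℤ) := by
    rintro x ⟨hx1, hx2⟩
    have hx2' : (x : ℝ) ≤ N := by exact_mod_cast hx2
    have hx1' : (0 : ℝ) < x := by exact_mod_cast hx1
    have : |((t : ℝ) * x + b)| ≤ 3 * p := by
      calc |((t : ℝ) * x + b)| ≤ |(t : ℝ) * x| + |(b : ℝ)| := abs_add_le _ _
        _ = t * x + |(b : ℝ)| := by rw [abs_of_pos (by positivity)]
        _ ≤ 2 * r * N + p / r := by
          gcongr
          exact htT'.trans hTr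
        _ ≤ 2 * (r * r) * N + p / 1 := by
          gcongr
          nlinarith
        _ = 3 * p := by rw [hpr]; ring
    exact_mod_cast this
  have hfib : ∀ z ∈ Icc (-(Z : ℤ)) Z, #{q ∈ S | g q = z} ≤ 2 * D + 2 := by
    intro z _
    rcases {q ∈ S | g q = z}.eq_empty_or_nonempty with he | ⟨q₁, hq₁⟩
    · simp [he]
    have hq₁' := mem_filter.1 hq₁
    refine (card_le_of_hyperbola (B := b) (n := (t * q₁.1 + b) * (t * q₁.2 + b)) ht0.ne' _
      (i1.mono (coe_subset.2 (filter_subset _ _)))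
      (i2.mono (coe_subset.2 (filter_subset _ _))) ?_).trans ?_
    · intro q hq
      rw [mem_filter] at hq
      have e1 := hg q hq.1
      have e2 := hg q₁ hq₁'.1
      rw [hq.2] at e1
      rw [hq₁'.2] at e2
      linear_combination t * (e1 - e2)
    · gcongr
      apply hD
      zify
      rw [abs_mul]
      calc _ ≤ (3 * (p : ℤ)) * (3 * (p : ℤ)) := by
            gcongr
            · exact hlin _ (hS1 _ hq₁'.1)
            · exact hlin _ (hS2 _ hq₁'.1)
        _ = _ := by ring
  have hcard : #S ≤ (2 * D + 2) * #(Icc (-(Z : ℤ)) Z) :=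
    card_le_mul_card_image_of_maps_to hgZ _ hfib
  have hI : #(Icc (-(Z : ℤ)) Z) = 2 * Z + 1 := by rw [Int.card_Icc]; omega
  have hZW : (Z : ℝ) ≤ 4 * W := Nat.floor_le (by positivity)
  rw [hI] at hcard
  have hcard' : (#S : ℝ) ≤ (2 * D + 2) * (2 * Z + 1) := by exact_mod_cast hcard
  have hWs : W ≤ √((N : ℝ) ^ 3 / p + 1) := Real.le_sqrt_of_sq_le (by rw [hW2]; linarith)
  have hWs1 : 1 ≤ √((N : ℝ) ^ 3 / p + 1) := by
    rw [Real.one_le_sqrt]; have : 0 ≤ (N : ℝ) ^ 3 / p := by positivity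
    linarith
  calc (#S : ℝ) ≤ (2 * D + 2) * (2 * Z + 1) := hcard'
    _ ≤ (2 * D + 2) * (9 * √((N : ℝ) ^ 3 / p + 1)) := by gcongr; linarith
    _ = _ := by ring

end Hyperbola

theorem exists_card_hyperbola_le {ε : ℝ} (hε : 0 < ε) :
    ∃ C : ℝ, 0 < C ∧ ∀ (p : ℕ) [Fact p.Prime] (N : ℕ) (s c : ZMod p) (S : Finset (ℤ × ℤ)),
      1 ≤ N → N < p → c ≠ 0 → (∀ q ∈ S, q.1 ∈ Set.Icc 1 (N : ℤ)) →
      (∀ q ∈ S, q.2 ∈ Set.Icc 1 (N : ℤ)) →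
      (∀ q ∈ S, ((q.1 : ZMod p) + s) * ((q.2 : ZMod p) + s) = c) →
      (#S : ℝ) ≤ C * (N : ℝ) ^ ε * √((N : ℝ) ^ 3 / p + 1) := by
  obtain ⟨C, hC, hdiv⟩ := exists_card_divisors_le_mul_rpow (ε := ε / 6) (by positivity)
  refine ⟨9 * (2 * (C * 144 ^ (ε / 6)) + 2), by positivity,
    fun p _ N s c S hN1 hN hc hS1 hS2 hS => ?_⟩
  have hN1' : (1 : ℝ) ≤ N := by exact_mod_cast hN1
  set D := ⌊C * (144 * (N : ℝ) ^ 6) ^ (ε / 6)⌋₊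
  have hD : ∀ m ≤ 144 * N ^ 6, #m.divisors ≤ D := by
    intro m hm
    rcases eq_or_ne m 0 with rfl | hm0
    · simp
    refine Nat.le_floor ((hdiv m hm0).trans ?_)
    gcongr
    exact_mod_cast hm
  have hDN : (D : ℝ) ≤ C * 144 ^ (ε / 6) * (N : ℝ) ^ ε := by
    refine (Nat.floor_le (by positivity)).trans_eq ?_
    rw [Real.mul_rpow (by norm_num) (by positivity), ← Real.rpow_natCast_mul (by positivity)]
    rw [mul_assoc]
    congr 3
    push_cast
    ring
  have hNε : 1 ≤ (N : ℝ) ^ ε := Real.one_le_rpow hN1' hε.le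
  have hp0 : (0 : ℝ) < p := by exact_mod_cast (Fact.out : p.Prime).pos
  have hs1 : 1 ≤ √((N : ℝ) ^ 3 / p + 1) := by
    rw [Real.one_le_sqrt]
    have : 0 ≤ (N : ℝ) ^ 3 / p := by positivity
    linarith
  have key : (#S : ℝ) ≤ 9 * √((N : ℝ) ^ 3 / p + 1) * (2 * D + 2) := by
    rcases lt_or_ge (4 * N ^ 3) p with h | h
    · have h1 : #S ≤ 2 * D + 2 := by
        refine card_hyperbola_le_of_short hN hc h (fun m hm => hD m (hm.trans ?_)) hS1 hS2 hS
        have : N ^ 4 ≤ N ^ 6 := Nat.pow_le_pow_right hN1 (by norm_num)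
        omega
      have h2 : (#S : ℝ) ≤ 2 * D + 2 := by exact_mod_cast h1
      have : (0 : ℝ) ≤ 2 * D + 2 := by positivity
      nlinarith
    · refine card_hyperbola_le hN hc (fun m hm => hD m (hm.trans ?_)) hS1 hS2 hS
      calc 9 * p ^ 2 ≤ 9 * (4 * N ^ 3) ^ 2 := by gcongr
        _ = _ := by ring
  calc (#S : ℝ) ≤ 9 * √((N : ℝ) ^ 3 / p + 1) * (2 * D + 2) := key
    _ ≤ 9 * √((N : ℝ) ^ 3 / p + 1) * (2 * (C * 144 ^ (ε / 6) * (N : ℝ) ^ ε) + 2 * (N : ℝ) ^ ε) := by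
      gcongr
      linarith
    _ = _ := by ring

section Interval

variable {p : ℕ} [Fact p.Prime] {a : ZMod p} {N : ℕ}

theorem lt_of_zero_notMem_interval (h : (0 : ZMod p) ∉ interval p a N) : N < p := by
  by_contra! hN
  have hlt := ZMod.val_lt a
  refine h (mem_image.2 ⟨p - a.val, mem_Icc.2 ⟨by omega, by omega⟩, ?_⟩)
  rw [Nat.cast_sub hlt.le]
  simp

theorem card_interval (h : N < p) : #(interval p a N) = N := by
  rw [interval, card_image_of_injOn, Nat.card_Icc, Nat.add_sub_cancel]
  intro i hi j hj hij
  simp only [coe_Icc, Set.mem_Icc] at hi hj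
  have := (ZMod.natCast_eq_natCast_iff' i j p).1 (add_left_cancel hij)
  rwa [Nat.mod_eq_of_lt (by omega), Nat.mod_eq_of_lt (by omega)] at this

end Interval

theorem exists_card_inv_add_inv_le {ε : ℝ} (hε : 0 < ε) :
    ∃ C : ℝ, 0 < C ∧ ∀ (p : ℕ) [Fact p.Prime] (a : ZMod p) (N : ℕ) (l : ZMod p),
      1 ≤ N → (0 : ZMod p) ∉ interval p a N → l ≠ 0 →
      (#{q ∈ interval p a N ×ˢ interval p a N | q.1⁻¹ + q.2⁻¹ = l} : ℝ) ≤
        C * (N : ℝ) ^ ε * √((N : ℝ) ^ 3 / p + 1) := by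
  obtain ⟨C, hC, hcard⟩ := exists_card_hyperbola_le hε
  refine ⟨C, hC, fun p _ a N l hN1 h0 hl => ?_⟩
  set S : Finset (ℤ × ℤ) := {q ∈ Icc (1 : ℤ) N ×ˢ Icc (1 : ℤ) N |
    ((q.1 : ZMod p) + (a - l⁻¹)) * ((q.2 : ZMod p) + (a - l⁻¹)) = l⁻¹ ^ 2} with hS
  have hsub : {q ∈ interval p a N ×ˢ interval p a N | q.1⁻¹ + q.2⁻¹ = l} ⊆
      S.image fun q => (a + (q.1 : ZMod p), a + (q.2 : ZMod p)) := by
    rintro ⟨u, v⟩ hq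
    obtain ⟨huv, he⟩ := mem_filter.1 hq
    obtain ⟨hu, hv⟩ := mem_product.1 huv
    have hu0 : u ≠ 0 := fun h => h0 (h ▸ hu)
    have hv0 : v ≠ 0 := fun h => h0 (h ▸ hv)
    obtain ⟨i, hi, hiu⟩ := mem_image.1 hu
    obtain ⟨j, hj, hjv⟩ := mem_image.1 hv
    rw [mem_Icc] at hi hj
    refine mem_image.2 ⟨((i : ℤ), (j : ℤ)), mem_filter.2 ⟨?_, ?_⟩, ?_⟩
    · simp only [mem_product, mem_Icc]
      omega
    · have e : v + u = l * (u * v) := by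
        rw [← he]
        field_simp
      have e' : l⁻¹ * (v + u) = u * v := by rw [e, inv_mul_cancel_left₀ hl]
      simp only [Int.cast_natCast]
      dsimp only at hiu hjv
      rw [show (i : ZMod p) + (a - l⁻¹) = u - l⁻¹ by rw [← hiu]; ring,
        show (j : ZMod p) + (a - l⁻¹) = v - l⁻¹ by rw [← hjv]; ring]
      linear_combination -e'
    · simpa using ⟨hiu, hjv⟩
  refine le_trans (by exact_mod_cast (card_le_card hsub).trans card_image_le)
    (hcard p N (a - l⁻¹) (l⁻¹ ^ 2) S hN1 (lt_of_zero_notMem_interval h0) (by simpa using hl)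
      ?_ ?_ ?_)
  · intro q hq
    simpa using (mem_product.1 (mem_filter.1 hq).1).1
  · intro q hq
    simpa using (mem_product.1 (mem_filter.1 hq).1).2
  · exact fun q hq => (mem_filter.1 hq).2

/-- Number of solutions of `f x - f y = f z - f w` with variables in `A`. -/
def diffEnergy {ι G : Type*} [AddGroup G] [DecidableEq G] (f : ι → G) (A : Finset ι) : ℕ :=
  #{q ∈ (A ×ˢ A) ×ˢ (A ×ˢ A) | f q.1.1 - f q.1.2 = f q.2.1 - f q.2.2}

theorem exists_diffEnergy_inv_le {ε : ℝ} (hε : 0 < ε) :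
    ∃ C : ℝ, 0 < C ∧ ∀ (p : ℕ) [Fact p.Prime] (a : ZMod p) (N : ℕ),
      1 ≤ N → (0 : ZMod p) ∉ interval p a N →
      (diffEnergy (fun x : ZMod p => x⁻¹) (interval p a N) : ℝ) ≤
        C * (N : ℝ) ^ ε * (N : ℝ) ^ 2 * √((N : ℝ) ^ 3 / p + 1) := by
  obtain ⟨C, hC, hcard⟩ := exists_card_inv_add_inv_le hε
  refine ⟨C + 1, by positivity, fun p _ a N hN1 h0 => ?_⟩
  have hI : #(interval p a N) = N := card_interval (lt_of_zero_notMem_interval h0)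
  set I := interval p a N
  set L := C * (N : ℝ) ^ ε * √((N : ℝ) ^ 3 / p + 1) with hL
  have hL0 : 0 ≤ L := by positivity
  have hcol : ∀ l : ZMod p, #{q ∈ I ×ˢ I | q.1⁻¹ + q.2⁻¹ = l} ≤ N := by
    intro l
    rw [← hI]
    refine card_le_card_of_injOn Prod.fst
      (fun q hq => (mem_product.1 (mem_filter.1 hq).1).1) ?_
    rintro ⟨x, y⟩ h1 ⟨x', y'⟩ h2 (rfl : x = x')
    have e1 := (mem_filter.1 h1).2
    have e2 := (mem_filter.1 h2).2
    exact Prod.ext rfl (inv_injective (add_left_cancel (e1.trans e2.symm)))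
  have hfib : diffEnergy (fun x : ZMod p => x⁻¹) I ≤
      ∑ r ∈ I ×ˢ I, #{q ∈ I ×ˢ I | q.1⁻¹ + q.2⁻¹ = r.1⁻¹ + r.2⁻¹} := by
    rw [diffEnergy, card_eq_sum_card_fiberwise (f := fun q => (q.1.1, q.2.2)) (t := I ×ˢ I)]
    · refine sum_le_sum fun r _ => card_le_card_of_injOn (fun q => (q.2.1, q.1.2)) ?_ ?_
      · rintro ⟨⟨x, y⟩, z, w⟩ hq
        simp only [coe_filter, Set.mem_ofPred_eq, mem_filter, mem_product] at hq ⊢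
        obtain ⟨⟨⟨⟨hx, hy⟩, hz, hw⟩, he⟩, rfl⟩ := hq
        exact ⟨⟨hz, hy⟩, by linear_combination -he⟩
      · rintro ⟨⟨x, y⟩, z, w⟩ hq ⟨⟨x', y'⟩, z', w'⟩ hq' h
        simp only [coe_filter, Set.mem_ofPred_eq, mem_filter, Prod.ext_iff] at hq hq' h ⊢
        simp [hq.2.1, hq.2.2, hq'.2.1, hq'.2.2, h.1, h.2]
    · rintro ⟨⟨x, y⟩, z, w⟩ hq
      simp only [coe_filter, Set.mem_ofPred_eq, mem_product] at hq
      simp only [coe_product, Set.mem_prod, mem_coe]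
      exact ⟨hq.1.1.1, hq.1.2.2⟩
  have hterm : ∀ r ∈ I ×ˢ I, (#{q ∈ I ×ˢ I | q.1⁻¹ + q.2⁻¹ = r.1⁻¹ + r.2⁻¹} : ℝ) ≤
      L + if r.1⁻¹ + r.2⁻¹ = 0 then (N : ℝ) else 0 := by
    intro r _
    split_ifs with h
    · have : (#{q ∈ I ×ˢ I | q.1⁻¹ + q.2⁻¹ = r.1⁻¹ + r.2⁻¹} : ℝ) ≤ N := by exact_mod_cast hcol _
      linarith
    · simpa using hcard p a N _ hN1 h0 h
  have hNε : 1 ≤ (N : ℝ) ^ ε := Real.one_le_rpow (by exact_mod_cast hN1) hε.le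
  have hs1 : 1 ≤ √((N : ℝ) ^ 3 / p + 1) := by
    rw [Real.one_le_sqrt]
    have : 0 ≤ (N : ℝ) ^ 3 / p := by positivity
    linarith
  calc (diffEnergy (fun x : ZMod p => x⁻¹) I : ℝ)
      ≤ ∑ r ∈ I ×ˢ I, (#{q ∈ I ×ˢ I | q.1⁻¹ + q.2⁻¹ = r.1⁻¹ + r.2⁻¹} : ℝ) := by
        exact_mod_cast hfib
    _ ≤ ∑ r ∈ I ×ˢ I, (L + if r.1⁻¹ + r.2⁻¹ = 0 then (N : ℝ) else 0) := sum_le_sum hterm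
    _ = (N : ℝ) ^ 2 * L + #{r ∈ I ×ˢ I | r.1⁻¹ + r.2⁻¹ = 0} * N := by
        rw [sum_add_distrib, sum_const, card_product, hI, ← sum_filter, sum_const]
        simp [sq]
    _ ≤ (N : ℝ) ^ 2 * L + N * N := by
        gcongr
        exact hcol 0
    _ ≤ (N : ℝ) ^ 2 * L + (N : ℝ) ^ 2 * ((N : ℝ) ^ ε * √((N : ℝ) ^ 3 / p + 1)) := by
        have : 1 ≤ (N : ℝ) ^ ε * √((N : ℝ) ^ 3 / p + 1) := one_le_mul_of_one_le_of_one_le hNε hs1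
        nlinarith [sq_nonneg (N : ℝ)]
    _ = _ := by rw [hL]; ring

theorem norm_sum_sq_eq {ι : Type*} (s : Finset ι) (c : ι → ℂ) :
    ((‖∑ i ∈ s, c i‖ ^ 2 : ℝ) : ℂ) = ∑ q ∈ s ×ˢ s, c q.1 * (starRingEnd ℂ) (c q.2) := by
  rw [Complex.ofReal_pow, ← Complex.mul_conj', map_sum, sum_mul_sum, sum_product]

theorem sum_card_fiber_sq_eq_diffEnergy {ι G : Type*} [AddGroup G] [Fintype G] [DecidableEq G]
    (f : ι → G) (A : Finset ι) :
    ∑ l : G, #{q ∈ A ×ˢ A | f q.1 - f q.2 = l} ^ 2 = diffEnergy f A := by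
  rw [diffEnergy, card_eq_sum_card_fiberwise (f := fun q => f q.1.1 - f q.1.2) (t := univ)
    (by simp)]
  refine sum_congr rfl fun l _ => ?_
  rw [sq, ← card_product]
  congr 1
  ext ⟨q, r⟩
  simp only [mem_product, mem_filter]
  constructor
  · rintro ⟨⟨h1, h2⟩, h3, h4⟩
    exact ⟨⟨⟨h1, h3⟩, h2.trans h4.symm⟩, h2⟩
  · rintro ⟨⟨⟨h1, h2⟩, h3⟩, h4⟩
    exact ⟨⟨h1, h4⟩, h2, h3 ▸ h4⟩

section Bilinear

variable {p : ℕ} [Fact p.Prime] {ψ : AddChar (ZMod p) ℂ} {ι κ : Type*}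

theorem norm_sum_addChar_sq_eq (ψ : AddChar (ZMod p) ℂ) (s : Finset ι) (f : ι → ZMod p)
    (c : ι → ℂ) (l : ZMod p) :
    ((‖∑ i ∈ s, c i * ψ (f i * l)‖ ^ 2 : ℝ) : ℂ) =
      ∑ q ∈ s ×ˢ s, c q.1 * (starRingEnd ℂ) (c q.2) * ψ ((f q.1 - f q.2) * l) := by
  rw [norm_sum_sq_eq]
  refine sum_congr rfl fun q _ => ?_
  rw [map_mul (starRingEnd ℂ), ← AddChar.map_neg_eq_conj, sub_mul, sub_eq_add_neg, AddChar.map_add_eq_mul]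
  ring

theorem sum_norm_sum_addChar_pow_four (hψ : ψ.IsPrimitive) (s : Finset ι) (f : ι → ZMod p) :
    ∑ l : ZMod p, ‖∑ i ∈ s, ψ (f i * l)‖ ^ 4 = p * diffEnergy f s := by
  have h4 : ∀ l : ZMod p, ((‖∑ i ∈ s, ψ (f i * l)‖ ^ 4 : ℝ) : ℂ) =
      ∑ q ∈ (s ×ˢ s) ×ˢ (s ×ˢ s), ψ (l * (f q.1.1 - f q.1.2 - (f q.2.1 - f q.2.2))) := by
    intro l
    have h1 := norm_sum_addChar_sq_eq ψ s f (fun _ => 1) l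
    simp only [one_mul, map_one] at h1
    have h2 := norm_sum_addChar_sq_eq ψ (s ×ˢ s) (fun q => f q.1 - f q.2) (fun _ => 1) l
    simp only [one_mul, map_one] at h2
    rw [← h1, Complex.norm_real, Real.norm_of_nonneg (by positivity), ← pow_mul] at h2
    rw [h2]
    exact sum_congr rfl fun q _ => by rw [mul_comm]
  have : ((∑ l : ZMod p, ‖∑ i ∈ s, ψ (f i * l)‖ ^ 4 : ℝ) : ℂ) = ((p * diffEnergy f s : ℝ) : ℂ) := by
    rw [Complex.ofReal_sum, sum_congr rfl fun l _ => h4 l, sum_comm]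
    simp_rw [AddChar.sum_mulShift _ hψ, ZMod.card, sub_eq_zero]
    rw [diffEnergy, card_filter]
    push_cast
    rw [mul_sum]
    exact sum_congr rfl fun q _ => by split_ifs <;> simp
  exact_mod_cast this

theorem norm_bilinear_addChar_sum_pow_eight_le (hψ : ψ.IsPrimitive) (A : Finset ι) (B : Finset κ)
    (f : ι → ZMod p) (g : κ → ZMod p) (α : ι → ℂ) (β : κ → ℂ) (hα : ∀ x ∈ A, ‖α x‖ ≤ 1)
    (hβ : ∀ y ∈ B, ‖β y‖ ≤ 1) :
    ‖∑ x ∈ A, ∑ y ∈ B, α x * β y * ψ (f x * g y)‖ ^ 8 ≤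
      (#A : ℝ) ^ 4 * (#B : ℝ) ^ 4 * p * diffEnergy f A * diffEnergy g B := by
  set S := ∑ x ∈ A, ∑ y ∈ B, α x * β y * ψ (f x * g y) with hS
  set V : ZMod p → ℂ := fun l => ∑ x ∈ A, ψ (f x * l) with hV
  set U : ι → ℂ := fun x => ∑ y ∈ B, β y * ψ (g y * f x) with hU
  have hSU : S = ∑ x ∈ A, α x * U x := by
    refine sum_congr rfl fun x _ => ?_
    rw [hU, mul_sum]
    exact sum_congr rfl fun y _ => by rw [mul_comm (g y)]; ring
  have h1 : ‖S‖ ≤ ∑ x ∈ A, ‖U x‖ := by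
    rw [hSU]
    refine norm_sum_le_of_le _ fun x hx => ?_
    rw [norm_mul]
    exact mul_le_of_le_one_left (norm_nonneg _) (hα x hx)
  have h2 : ∑ x ∈ A, ‖U x‖ ^ 2 ≤ ∑ q ∈ B ×ˢ B, ‖V (g q.1 - g q.2)‖ := by
    have e : ((∑ x ∈ A, ‖U x‖ ^ 2 : ℝ) : ℂ) =
        ∑ q ∈ B ×ˢ B, β q.1 * (starRingEnd ℂ) (β q.2) * V (g q.1 - g q.2) := by
      rw [Complex.ofReal_sum, sum_congr rfl fun x _ => norm_sum_addChar_sq_eq ψ B g β (f x),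
        sum_comm]
      refine sum_congr rfl fun q _ => ?_
      rw [hV, mul_sum]
      exact sum_congr rfl fun x _ => by rw [mul_comm (f x)]
    calc ∑ x ∈ A, ‖U x‖ ^ 2 = ‖((∑ x ∈ A, ‖U x‖ ^ 2 : ℝ) : ℂ)‖ := by
          rw [Complex.norm_real, Real.norm_of_nonneg (sum_nonneg fun _ _ => by positivity)]
      _ ≤ _ := by
          rw [e]
          refine norm_sum_le_of_le _ fun q hq => ?_
          obtain ⟨hq1, hq2⟩ := mem_product.1 hq
          rw [norm_mul, norm_mul, RCLike.norm_conj]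
          exact mul_le_of_le_one_left (norm_nonneg _)
            (mul_le_one₀ (hβ _ hq1) (norm_nonneg _) (hβ _ hq2))
  have h3 : ‖S‖ ^ 2 ≤ #A * ∑ q ∈ B ×ˢ B, ‖V (g q.1 - g q.2)‖ := by
    calc ‖S‖ ^ 2 ≤ (∑ x ∈ A, ‖U x‖) ^ 2 := by gcongr
      _ ≤ #A * ∑ x ∈ A, ‖U x‖ ^ 2 := sq_sum_le_card_mul_sum_sq
      _ ≤ _ := by gcongr
  have h4 : (∑ q ∈ B ×ˢ B, ‖V (g q.1 - g q.2)‖) ^ 2 ≤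
      (#B : ℝ) ^ 2 * ∑ l, (#{q ∈ B ×ˢ B | g q.1 - g q.2 = l} : ℝ) * ‖V l‖ ^ 2 := by
    refine sq_sum_le_card_mul_sum_sq.trans_eq ?_
    rw [card_product, Nat.cast_mul, ← sq, ← sum_fiberwise' (B ×ˢ B)
      (fun q => g q.1 - g q.2) (fun l => ‖V l‖ ^ 2)]
    simp only [sum_const, nsmul_eq_mul]
  have h5 : (∑ l, (#{q ∈ B ×ˢ B | g q.1 - g q.2 = l} : ℝ) * ‖V l‖ ^ 2) ^ 2 ≤
      diffEnergy g B * (p * diffEnergy f A) := by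
    refine (sum_mul_sq_le_sq_mul_sq _ _ _).trans_eq ?_
    rw [← sum_norm_sum_addChar_pow_four hψ, ← sum_card_fiber_sq_eq_diffEnergy]
    push_cast
    congr 1
    exact sum_congr rfl fun l _ => by rw [← pow_mul]
  calc ‖S‖ ^ 8 = ((‖S‖ ^ 2) ^ 2) ^ 2 := by ring
    _ ≤ ((#A * ∑ q ∈ B ×ˢ B, ‖V (g q.1 - g q.2)‖) ^ 2) ^ 2 := by gcongr
    _ = (#A : ℝ) ^ 4 * ((∑ q ∈ B ×ˢ B, ‖V (g q.1 - g q.2)‖) ^ 2) ^ 2 := by ring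
    _ ≤ (#A : ℝ) ^ 4 * ((#B : ℝ) ^ 2 *
          ∑ l, (#{q ∈ B ×ˢ B | g q.1 - g q.2 = l} : ℝ) * ‖V l‖ ^ 2) ^ 2 := by gcongr
    _ = (#A : ℝ) ^ 4 * (#B : ℝ) ^ 4 *
          (∑ l, (#{q ∈ B ×ˢ B | g q.1 - g q.2 = l} : ℝ) * ‖V l‖ ^ 2) ^ 2 := by ring
    _ ≤ (#A : ℝ) ^ 4 * (#B : ℝ) ^ 4 * (diffEnergy g B * (p * diffEnergy f A)) := by gcongr
    _ = _ := by ring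

end Bilinear

theorem diffEnergy_const_mul {ι F : Type*} [Field F] [DecidableEq F] {b : F} (hb : b ≠ 0)
    (f : ι → F) (A : Finset ι) : diffEnergy (fun x => b * f x) A = diffEnergy f A := by
  simp only [diffEnergy, ← mul_sub, mul_right_inj' hb]

theorem ep_eq_stdAddChar (p : ℕ) [NeZero p] (z : ZMod p) : ep p z = ZMod.stdAddChar z := by
  rw [ZMod.stdAddChar_apply, ZMod.toCircle_apply, ep]

/-- bilinear Kloosterman sums over intervals in arbitrary position. -/
theorem stmt_10 (ε : ℝ) (hε : 0 < ε) :
    ∃ C : ℝ, 0 < C ∧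
      ∀ (p : ℕ), p.Prime → ∀ (a1 a2 : ZMod p) (N1 N2 : ℕ),
        (0 : ZMod p) ∉ interval p a1 N1 →
        (0 : ZMod p) ∉ interval p a2 N2 →
        ∀ α1 α2 : ZMod p → ℂ,
          (∀ x ∈ interval p a1 N1, ‖α1 x‖ ≤ 1) →
          (∀ x ∈ interval p a2 N2, ‖α2 x‖ ≤ 1) →
          ∀ b : ZMod p, b ≠ 0 →
            ‖∑ x1 ∈ interval p a1 N1, ∑ x2 ∈ interval p a2 N2,
                α1 x1 * α2 x2 * ep p (b * x1⁻¹ * x2⁻¹)‖ ≤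
              C * (((interval p a1 N1).card : ℝ) * ((interval p a2 N2).card : ℝ)) ^ ε *
                (p : ℝ) ^ ((1 : ℝ) / 8) *
                ((interval p a1 N1).card : ℝ) ^ ((3 : ℝ) / 4) *
                ((interval p a2 N2).card : ℝ) ^ ((3 : ℝ) / 4) *
                (((interval p a1 N1).card : ℝ) ^ 3 / (p : ℝ) + 1) ^ ((1 : ℝ) / 16) *
                (((interval p a2 N2).card : ℝ) ^ 3 / (p : ℝ) + 1) ^ ((1 : ℝ) / 16) := by
  obtain ⟨C, hC, hE⟩ := exists_diffEnergy_inv_le (ε := 8 * ε) (by positivity)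
  refine ⟨(C ^ 2) ^ ((1 : ℝ) / 8), by positivity, ?_⟩
  intro p hp a1 a2 N1 N2 h1 h2 α1 α2 hα1 hα2 b hb
  have : Fact p.Prime := ⟨hp⟩
  have hp0 : (0 : ℝ) < p := by exact_mod_cast hp.pos
  have hmain := norm_bilinear_addChar_sum_pow_eight_le (ZMod.isPrimitive_stdAddChar p)
    (interval p a1 N1) (interval p a2 N2) (fun x => b * x⁻¹) (fun x => x⁻¹) α1 α2 hα1 hα2
  simp only [← ep_eq_stdAddChar, diffEnergy_const_mul hb] at hmain
  rw [card_interval (lt_of_zero_notMem_interval h1),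
    card_interval (lt_of_zero_notMem_interval h2)] at hmain ⊢
  set S := ∑ x1 ∈ interval p a1 N1, ∑ x2 ∈ interval p a2 N2,
    α1 x1 * α2 x2 * ep p (b * x1⁻¹ * x2⁻¹) with hS
  rcases Nat.eq_zero_or_pos N1 with hN1 | hN1
  · have : S = 0 := by simp [hS, hN1, interval]
    rw [this, norm_zero]
    positivity
  rcases Nat.eq_zero_or_pos N2 with hN2 | hN2
  · have : S = 0 := by simp [hS, hN2, interval]
    rw [this, norm_zero]
    positivity
  have hE1 := hE p a1 N1 hN1 h1
  have hE2 := hE p a2 N2 hN2 h2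
  set x := (N1 : ℝ)
  set y := (N2 : ℝ)
  have hx : 0 < x := Nat.cast_pos.2 hN1
  have hy : 0 < y := Nat.cast_pos.2 hN2
  set X := x ^ 3 / (p : ℝ) + 1
  set Y := y ^ 3 / (p : ℝ) + 1
  have hX : 0 < X := by positivity
  have hY : 0 < Y := by positivity
  refine le_of_pow_le_pow_left₀ (n := 8) (by norm_num) (by positivity) (hmain.trans ?_)
  have r : ∀ {z : ℝ} (s : ℝ), 0 < z → (z ^ s) ^ 8 = z ^ (s * 8) := fun s hz => by
    rw [← Real.rpow_mul_natCast hz.le]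
    norm_num
  have e : ((C ^ 2) ^ ((1 : ℝ) / 8) * (x * y) ^ ε * (p : ℝ) ^ ((1 : ℝ) / 8) * x ^ ((3 : ℝ) / 4) *
      y ^ ((3 : ℝ) / 4) * X ^ ((1 : ℝ) / 16) * Y ^ ((1 : ℝ) / 16)) ^ 8 =
      x ^ 4 * y ^ 4 * p * (C * x ^ (8 * ε) * x ^ 2 * √X) * (C * y ^ (8 * ε) * y ^ 2 * √Y) := by
    simp only [mul_pow]
    rw [r _ (by positivity), r _ (by positivity), r _ hp0, r _ hx, r _ hy, r _ hX, r _ hY,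
      Real.mul_rpow hx.le hy.le, Real.sqrt_eq_rpow, Real.sqrt_eq_rpow, mul_comm ε 8]
    norm_num [show (3 : ℝ) / 4 * 8 = (6 : ℕ) by norm_num]
    ring
  rw [e]
  gcongr
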